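/- Let n be a positive integer, let h : ℝ → ℝ be any function, and let ω > 0 and γ be real numbers. Let U and V be real orthogonal n×n matrices (UᵀU = I and VᵀV = I), let t : Fin n → ℝ be a nonincreasing function with nonnegative values, and set T = U · diag(t) · Vᵀ. For an n×n real matrix Q define H(Q) = Σ_i h(√(λ_i(QᵀQ))), where λ_1(QᵀQ), …, λ_n(QᵀQ) are the eigenvalues (with multiplicity) of the real symmetric positive semidefinite matrix QᵀQ. Suppose σ* : Fin n → ℝ has nonnegative values and minimizes the vector problem, i.e., for every s : Fin n → ℝ one has Σ_i h(σ*_i) + (ω/2)·Σ_i (σ*_i − t_i)² ≤ Σ_i h(s_i) + (ω/2)·Σ_i (s_i − t_i)². Then the matrix Q* = U · diag(σ*) · Vᵀ minimizes the matrix problem: for every n×n real matrix Q, H(Q*) + (ω/2)·‖Q* − T‖_F² ≤ H(Q) + (ω/2)·‖Q − T‖_F². -/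

import Mathlib

open Matrix

lemma aux_svd {n : ℕ} (Q : Matrix (Fin n) (Fin n) ℝ) :
    ∃ X Y : Matrix (Fin n) (Fin n) ℝ, Xᵀ * X = 1 ∧ Yᵀ * Y = 1 ∧
      Q = X * Matrix.diagonal (fun i => Real.sqrt
        ((Matrix.isHermitian_conjTranspose_mul_self Q).eigenvalues i)) * Yᵀ := by
  set hA := Matrix.isHermitian_conjTranspose_mul_self Q with hAdef
  set l := hA.eigenvalues with hl
  have hl0 : ∀ i, 0 ≤ l i := fun i => eigenvalues_conjTranspose_mul_self_nonneg Q i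
  set Y : Matrix (Fin n) (Fin n) ℝ := (hA.eigenvectorUnitary : Matrix (Fin n) (Fin n) ℝ) with hY
  have hYY : Yᵀ * Y = 1 := by
    have := Unitary.coe_star_mul_self hA.eigenvectorUnitary
    rwa [star_eq_conjTranspose, conjTranspose_eq_transpose_of_trivial] at this
  have hYY' : Y * Yᵀ = 1 := mul_eq_one_comm.mp hYY
  have hspec : Qᵀ * Q = Y * diagonal l * Yᵀ := by
    have := hA.spectral_theorem
    rw [Unitary.conjStarAlgAut_apply] at this
    simpa [star_eq_conjTranspose, conjTranspose_eq_transpose_of_trivial] using! this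
  set B := Q * Y with hB
  have hBB : Bᵀ * B = diagonal l := by
    calc Bᵀ * B = Yᵀ * (Qᵀ * Q) * Y := by rw [hB, transpose_mul]; simp only [Matrix.mul_assoc]
      _ = (Yᵀ * Y) * diagonal l * (Yᵀ * Y) := by rw [hspec]; simp only [Matrix.mul_assoc]
      _ = _ := by rw [hYY]; simp
  have hBij : ∀ i j, ∑ k, B k i * B k j = if i = j then l i else 0 := by
    intro i j
    have := congrFun (congrFun hBB i) j
    simpa [Matrix.mul_apply, diagonal_apply] using this
  let v : Fin n → EuclideanSpace ℝ (Fin n) := fun i => WithLp.toLp 2 (fun k => B k i / √(l i))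
  have hv : Orthonormal ℝ (({i | l i ≠ 0} : Set (Fin n)).domRestrict v) := by
    rw [orthonormal_iff_ite]
    rintro ⟨i, hi⟩ ⟨j, hj⟩
    have : inner ℝ (v i) (v j) = (∑ k, B k i * B k j) / (√(l i) * √(l j)) := by
      simp only [v, PiLp.inner_apply, Finset.sum_div]
      refine Finset.sum_congr rfl fun k _ => ?_
      simp
      ring
    simp only [Set.domRestrict_apply, this, hBij, Subtype.mk.injEq]
    split_ifs with hij
    · subst hij
      rw [Real.mul_self_sqrt (hl0 i)]
      exact div_self hi
    · simp
  obtain ⟨b, hb⟩ := hv.exists_orthonormalBasis_extension_of_card_eq (by simp)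
  refine ⟨Matrix.of fun k i => b i k, Y, ?_, hYY, ?_⟩
  · ext i j
    have := orthonormal_iff_ite.mp b.orthonormal i j
    simp only [PiLp.inner_apply] at this
    simp only [Matrix.mul_apply, transpose_apply, of_apply, one_apply, ← this]
    refine Finset.sum_congr rfl fun k _ => ?_
    simp [mul_comm]
  · have : B = (Matrix.of fun k i => b i k) * diagonal (fun i => √(l i)) := by
      ext k i
      rw [mul_diagonal, of_apply]
      by_cases hi : l i = 0
      · have h1 := hBij i i
        rw [if_pos rfl, hi, Finset.sum_eq_zero_iff_of_nonneg (fun k _ => mul_self_nonneg _)] at h1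
        have := h1 k (Finset.mem_univ _)
        rw [mul_self_eq_zero.mp this, hi]; simp
      · rw [hb i hi]
        have : √(l i) ≠ 0 := by
          rw [Real.sqrt_ne_zero (hl0 i)]; exact hi
        simp only [v]
        field_simp
    rw [← this, hB, Matrix.mul_assoc, hYY', Matrix.mul_one]

lemma aux_trace {n : ℕ} (X Y U V : Matrix (Fin n) (Fin n) ℝ) (s t : Fin n → ℝ) :
    trace ((X * diagonal s * Yᵀ)ᵀ * (U * diagonal t * Vᵀ)) =
      ∑ i, ∑ j, s i * t j * ((Xᵀ * U) i j * (Yᵀ * V) i j) := by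
  have : trace ((X * diagonal s * Yᵀ)ᵀ * (U * diagonal t * Vᵀ)) =
      trace ((diagonal s * (Xᵀ * U) * diagonal t) * (Yᵀ * V)ᵀ) := by
    simp only [transpose_mul, transpose_transpose, diagonal_transpose, Matrix.mul_assoc]
    rw [trace_mul_comm]
    simp only [Matrix.mul_assoc]
  rw [this, trace]
  refine Finset.sum_congr rfl fun i _ => ?_
  rw [diag_apply, Matrix.mul_apply]
  refine Finset.sum_congr rfl fun j _ => ?_
  rw [mul_diagonal, diagonal_mul, transpose_apply]
  ring

lemma aux_trace_self {n : ℕ} (X Y : Matrix (Fin n) (Fin n) ℝ) (s : Fin n → ℝ)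
    (hX : Xᵀ * X = 1) (hY : Yᵀ * Y = 1) :
    trace ((X * diagonal s * Yᵀ)ᵀ * (X * diagonal s * Yᵀ)) = ∑ i, s i ^ 2 := by
  rw [aux_trace, hX, hY]
  refine Finset.sum_congr rfl fun i _ => ?_
  simp [one_apply, pow_two]

lemma aux_orth {n : ℕ} (A : Matrix (Fin n) (Fin n) ℝ) (hA : Aᵀ * A = 1) :
    (∀ i, ∑ j, A i j ^ 2 = 1) ∧ ∀ j, ∑ i, A i j ^ 2 = 1 := by
  have hA' : A * Aᵀ = 1 := mul_eq_one_comm.mp hA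
  constructor
  · intro i
    simpa [Matrix.mul_apply, pow_two] using congrFun (congrFun hA' i) i
  · intro i
    simpa [Matrix.mul_apply, pow_two] using congrFun (congrFun hA i) i

lemma aux_vn {n : ℕ} (A B : Matrix (Fin n) (Fin n) ℝ) (hA : Aᵀ * A = 1) (hB : Bᵀ * B = 1)
    (s t : Fin n → ℝ) (hs : ∀ i, 0 ≤ s i) (ht : ∀ i, 0 ≤ t i) :
    ∃ π : Equiv.Perm (Fin n),
      ∑ i, ∑ j, s i * t j * (A i j * B i j) ≤ ∑ i, s i * t (π i) := by
  let D : Matrix (Fin n) (Fin n) ℝ := Matrix.of fun i j => (A i j ^ 2 + B i j ^ 2) / 2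
  have hD : D ∈ doublyStochastic ℝ (Fin n) := by
    rw [mem_doublyStochastic_iff_sum]
    refine ⟨fun i j => ?_, fun i => ?_, fun j => ?_⟩
    · simp only [D, of_apply]; positivity
    · simp only [D, of_apply, ← Finset.sum_div, Finset.sum_add_distrib, (aux_orth A hA).1,
        (aux_orth B hB).1]; norm_num
    · simp only [D, of_apply, ← Finset.sum_div, Finset.sum_add_distrib, (aux_orth A hA).2,
        (aux_orth B hB).2]; norm_num
  let F : Matrix (Fin n) (Fin n) ℝ →ₗ[ℝ] ℝ :=
    { toFun := fun M => ∑ i, ∑ j, s i * t j * M i j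
      map_add' := fun M N => by simp only [Matrix.add_apply, mul_add, Finset.sum_add_distrib]
      map_smul' := fun c M => by
        simp only [Matrix.smul_apply, smul_eq_mul, Finset.mul_sum, RingHom.id_apply]
        refine Finset.sum_congr rfl fun i _ => Finset.sum_congr rfl fun j _ => ?_
        ring }
  rw [← SetLike.mem_coe, doublyStochastic_eq_convexHull_permMatrix] at hD
  obtain ⟨_, ⟨π, rfl⟩, hπ⟩ :=
    (F.convexOn convex_univ).exists_ge_of_mem_convexHull (Set.subset_univ _) hD
  refine ⟨π, ?_⟩
  calc _ ≤ F D := by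
        change _ ≤ ∑ i, ∑ j, s i * t j * D i j
        refine Finset.sum_le_sum fun i _ => Finset.sum_le_sum fun j _ => ?_
        refine mul_le_mul_of_nonneg_left ?_ (mul_nonneg (hs i) (ht j))
        simp only [D, of_apply]
        nlinarith [sq_nonneg (A i j - B i j)]
    _ ≤ _ := hπ
    _ = _ := by
        change ∑ i, ∑ j, s i * t j * (π.permMatrix ℝ) i j = _
        refine Finset.sum_congr rfl fun i _ => ?_
        simp [Equiv.Perm.permMatrix, PEquiv.toMatrix_apply, Equiv.toPEquiv_apply]

lemma aux_eig {n : ℕ} (U V : Matrix (Fin n) (Fin n) ℝ) (hU : Uᵀ * U = 1) (hV : Vᵀ * V = 1)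
    (h : ℝ → ℝ) (s : Fin n → ℝ) (hs : ∀ i, 0 ≤ s i) (Q : Matrix (Fin n) (Fin n) ℝ)
    (hQ : Q = U * diagonal s * Vᵀ) :
    ∑ i, h (Real.sqrt ((Matrix.isHermitian_conjTranspose_mul_self Q).eigenvalues i)) =
      ∑ i, h (s i) := by
  have h1 : (Qᴴ * Q).charpoly = (diagonal (fun i => s i ^ 2)).charpoly := by
    have : Qᴴ * Q = V * (diagonal (fun i => s i ^ 2) * Vᵀ) := by
      rw [conjTranspose_eq_transpose_of_trivial, hQ]
      calc _ = V * (diagonal s * (Uᵀ * U) * diagonal s * Vᵀ) := by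
            simp only [transpose_mul, transpose_transpose, diagonal_transpose, Matrix.mul_assoc]
        _ = _ := by rw [hU, Matrix.mul_one, diagonal_mul_diagonal]; simp only [pow_two]
    rw [this, charpoly_mul_comm, Matrix.mul_assoc, hV, Matrix.mul_one]
  have h2 := (Matrix.isHermitian_conjTranspose_mul_self Q).roots_charpoly_eq_eigenvalues
  rw [h1, charpoly_diagonal, Polynomial.roots_prod _ _
    (Finset.prod_ne_zero_iff.mpr fun i _ => Polynomial.X_sub_C_ne_zero _)] at h2
  have h3 := congrArg (fun m => (m.map (fun x => h (√x))).sum) h2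
  simp only [Polynomial.roots_X_sub_C, Multiset.bind_singleton, Multiset.map_map] at h3
  have h4 : ∀ i, √(s i ^ 2) = s i := fun i => Real.sqrt_sq (hs i)
  simpa [Finset.sum, h4, Function.comp_def] using h3.symm



/-- Theorem 1 of the paper (Moreau–Yosida proximal operator for unitarily
invariant functions, square-matrix case): if `σ*` minimizes the vector proximal
problem for the singular values, then `Q* = U diag(σ*) Vᵀ` minimizes the matrix
proximal problem. -/
theorem stmt_0 (n : ℕ) (hn : 0 < n) (h : ℝ → ℝ) (ω γ : ℝ) (hω : 0 < ω)
    (U V : Matrix (Fin n) (Fin n) ℝ)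
    (hU : Uᵀ * U = 1) (hV : Vᵀ * V = 1)
    (t : Fin n → ℝ) (ht_anti : Antitone t) (ht_nonneg : ∀ i, 0 ≤ t i)
    (T : Matrix (Fin n) (Fin n) ℝ) (hT : T = U * Matrix.diagonal t * Vᵀ)
    (H : Matrix (Fin n) (Fin n) ℝ → ℝ)
    (hH : ∀ Q : Matrix (Fin n) (Fin n) ℝ,
      H Q = ∑ i, h (Real.sqrt ((Matrix.isHermitian_conjTranspose_mul_self Q).eigenvalues i)))
    (σs : Fin n → ℝ) (hσ_nonneg : ∀ i, 0 ≤ σs i)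
    (hσ_min : ∀ s : Fin n → ℝ,
      (∑ i, h (σs i)) + ω / 2 * ∑ i, (σs i - t i) ^ 2 ≤
        (∑ i, h (s i)) + ω / 2 * ∑ i, (s i - t i) ^ 2)
    (Qstar : Matrix (Fin n) (Fin n) ℝ)
    (hQstar : Qstar = U * Matrix.diagonal σs * Vᵀ) :
    ∀ Q : Matrix (Fin n) (Fin n) ℝ,
      H Qstar + ω / 2 * Matrix.trace ((Qstar - T)ᵀ * (Qstar - T)) ≤
        H Q + ω / 2 * Matrix.trace ((Q - T)ᵀ * (Q - T)) := by
  intro Q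
  obtain ⟨X, Y, hX, hY, hQ⟩ := aux_svd Q
  rw [hH, hH, aux_eig U V hU hV h σs hσ_nonneg Qstar hQstar]
  set s : Fin n → ℝ := fun i => Real.sqrt
        ((Matrix.isHermitian_conjTranspose_mul_self Q).eigenvalues i) with hs
  have hs0 : ∀ i, 0 ≤ s i := fun i => Real.sqrt_nonneg _
  have horth : ∀ Z W : Matrix (Fin n) (Fin n) ℝ, Zᵀ * Z = 1 → Wᵀ * W = 1 →
      (Zᵀ * W)ᵀ * (Zᵀ * W) = 1 := by
    intro Z W hZ hW
    have hZ' : Z * Zᵀ = 1 := mul_eq_one_comm.mp hZ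
    rw [transpose_mul, transpose_transpose, Matrix.mul_assoc, ← Matrix.mul_assoc Z, hZ',
      Matrix.one_mul, hW]
  obtain ⟨π, hπ⟩ := aux_vn (Xᵀ * U) (Yᵀ * V) (horth X U hX hU) (horth Y V hY hV) s t hs0 ht_nonneg
  have e1 : trace ((Qstar - T)ᵀ * (Qstar - T)) = ∑ i, (σs i - t i) ^ 2 := by
    have : Qstar - T = U * diagonal (fun i => σs i - t i) * Vᵀ := by
      rw [hQstar, hT, ← diagonal_sub, Matrix.mul_sub, Matrix.sub_mul]
    rw [this, aux_trace_self U V _ hU hV]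
  have e2 : trace ((Q - T)ᵀ * (Q - T)) =
      trace (Qᵀ * Q) - 2 * trace (Qᵀ * T) + trace (Tᵀ * T) := by
    have : trace (Tᵀ * Q) = trace (Qᵀ * T) := by
      rw [← trace_transpose, transpose_mul, transpose_transpose]
    rw [transpose_sub, Matrix.sub_mul, Matrix.mul_sub, Matrix.mul_sub, trace_sub, trace_sub,
      trace_sub, this]
    ring
  have e3 : trace (Qᵀ * Q) = ∑ i, s i ^ 2 := by
    conv_lhs => rw [hQ]
    exact aux_trace_self X Y s hX hY
  have e4 : trace (Tᵀ * T) = ∑ i, t (π i) ^ 2 := by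
    rw [hT, aux_trace_self U V t hU hV]
    exact (Equiv.sum_comp π (fun i => t i ^ 2)).symm
  have e5 : trace (Qᵀ * T) ≤ ∑ i, s i * t (π i) := by
    refine le_trans (le_of_eq ?_) hπ
    conv_lhs => rw [hQ, hT]
    exact aux_trace X Y U V s t
  have e6 : ∑ i, (s i - t (π i)) ^ 2 ≤ trace ((Q - T)ᵀ * (Q - T)) := by
    have : ∑ i, (s i - t (π i)) ^ 2 =
        ∑ i, s i ^ 2 - 2 * ∑ i, s i * t (π i) + ∑ i, t (π i) ^ 2 := by
      rw [Finset.mul_sum, ← Finset.sum_sub_distrib, ← Finset.sum_add_distrib]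
      exact Finset.sum_congr rfl fun i _ => by ring
    rw [this, e2, e3, e4]
    linarith
  have key := hσ_min (fun i => s (π.symm i))
  have k1 : ∑ i, h (s (π.symm i)) = ∑ i, h (s i) := Equiv.sum_comp π.symm (fun i => h (s i))
  have k2 : ∑ i, (s (π.symm i) - t i) ^ 2 = ∑ i, (s i - t (π i)) ^ 2 := by
    rw [← Equiv.sum_comp π]
    simp
  rw [k1, k2] at key
  rw [e1]
  refine key.trans ?_
  gcongr
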